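/- arXiv:0905.1745 — 4 statements merged into one kernel-verified Lean document; each statement's English description precedes it below -/
import Mathlib

section
/- Let ρ ≥ 1 and α ≥ 1 be real numbers and let b be a real number with 0 < b ≤ 1. Then (2/3)·log₂(1+ρ) + (1/3)·log₂(1 + 2ρ^{α−1} + ρ^{2α−2}·b) − (1/3)·log₂(1 + 2ρ^α + ρ^{2α}·b) ≤ 4/3 − (1/3)·log₂ b. -/
open Real

/-- strong-interference gap bound. -/
theorem strong_gap_bound (ρ α b : ℝ) (hρ : 1 ≤ ρ) (hα : 1 ≤ α) (hb0 : 0 < b) (hb1 : b ≤ 1) :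
    (2 / 3) * Real.logb 2 (1 + ρ)
      + (1 / 3) * Real.logb 2 (1 + 2 * ρ ^ (α - 1) + ρ ^ (2 * α - 2) * b)
      - (1 / 3) * Real.logb 2 (1 + 2 * ρ ^ α + ρ ^ (2 * α) * b)
    ≤ 4 / 3 - (1 / 3) * Real.logb 2 b := by
  have hρ0 : 0 < ρ := by linarith
  have hx : 1 ≤ ρ ^ (α - 1) := Real.one_le_rpow hρ (by linarith)
  have e1 : ρ ^ (2 * α - 2) = (ρ ^ (α - 1)) ^ 2 := by
    rw [← Real.rpow_natCast, ← Real.rpow_mul hρ0.le]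
    congr 1; push_cast; ring
  have e2 : ρ ^ α = ρ * ρ ^ (α - 1) := by
    rw [Real.rpow_sub_one hρ0.ne']; field_simp
  have e3 : ρ ^ (2 * α) = (ρ * ρ ^ (α - 1)) ^ 2 := by
    rw [← e2, ← Real.rpow_natCast, ← Real.rpow_mul hρ0.le]
    congr 1; push_cast; ring
  rw [e1, e3, e2]
  generalize ρ ^ (α - 1) = x at hx
  have hx0 : 0 < x := by linarith
  have hA : 0 < 1 + 2 * x + x ^ 2 * b := by positivity
  have hB : 0 < 1 + 2 * (ρ * x) + (ρ * x) ^ 2 * b := by positivity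
  have h1 : (1 + ρ) ^ 2 ≤ 4 * ρ ^ 2 := by nlinarith
  have h2 : 1 + 2 * x + x ^ 2 * b ≤ 4 * x ^ 2 := by
    have : x ^ 2 * b ≤ x ^ 2 := mul_le_of_le_one_right (by positivity) hb1
    nlinarith
  have key : (1 + ρ) ^ 2 * (1 + 2 * x + x ^ 2 * b) * b
      ≤ 2 ^ 4 * (1 + 2 * (ρ * x) + (ρ * x) ^ 2 * b) := by
    calc _ ≤ (4 * ρ ^ 2) * (4 * x ^ 2) * b := by gcongr
      _ ≤ _ := by
        have : 0 < ρ * x := by positivity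
        nlinarith
  have hl := Real.logb_le_logb_of_le (b := 2) (by norm_num) (by positivity) key
  rw [Real.logb_mul (by positivity) hb0.ne', Real.logb_mul (by positivity) hA.ne',
    Real.logb_mul (by positivity) hB.ne', Real.logb_pow, Real.logb_pow,
    Real.logb_self_eq_one (by norm_num)] at hl
  push_cast at hl
  linarith
end

section
/- Let ρ ≥ 1 be a real number, let α be a real number with 0 ≤ α ≤ 1, and let b be a real number with 0 < b ≤ 1. Then (1/3)·log₂( (1+ρ)² / ( (1 + 2ρ^α + ρ^{2α}·b)·(1 + ρ^{1−α})² ) ) + (4/3)·log₂(3 + b) ≤ 8/3 − (1/3)·log₂ b. -/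
open Real

/-- weak-interference gap bound. -/
theorem weak_gap_bound (ρ α b : ℝ) (hρ : 1 ≤ ρ) (hα0 : 0 ≤ α) (hα1 : α ≤ 1)
    (hb0 : 0 < b) (hb1 : b ≤ 1) :
    (1 / 3) * Real.logb 2
        ((1 + ρ) ^ 2 / ((1 + 2 * ρ ^ α + ρ ^ (2 * α) * b) * (1 + ρ ^ (1 - α)) ^ 2))
      + (4 / 3) * Real.logb 2 (3 + b)
    ≤ 8 / 3 - (1 / 3) * Real.logb 2 b := by
  have hp : 0 < ρ := by linarith
  have h2 : ρ ^ (2 * α) = ρ ^ α * ρ ^ α := by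
    rw [← Real.rpow_add hp]; ring_nf
  have hxy : ρ ^ α * ρ ^ (1 - α) = ρ := by
    rw [← Real.rpow_add hp]; simp
  have hx : 0 < ρ ^ α := Real.rpow_pos_of_pos hp _
  have hy : 0 < ρ ^ (1 - α) := Real.rpow_pos_of_pos hp _
  rw [h2]
  generalize ρ ^ α = x at *
  generalize ρ ^ (1 - α) = y at *
  have h1 : Real.logb 2 ((1 + ρ) ^ 2 / ((1 + 2 * x + x * x * b) * (1 + y) ^ 2))
      ≤ Real.logb 2 b⁻¹ := by
    apply Real.logb_le_logb_of_le (by norm_num) (by positivity)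
    rw [div_le_iff₀ (by positivity), inv_mul_eq_div, le_div_iff₀ hb0]
    have e1 : b * (1 + x) ^ 2 ≤ 1 + 2 * x + x * x * b := by nlinarith
    have e2 : (1 + ρ) ^ 2 ≤ ((1 + x) * (1 + y)) ^ 2 := by
      apply pow_le_pow_left₀ (by positivity)
      nlinarith
    calc (1 + ρ) ^ 2 * b ≤ ((1 + x) * (1 + y)) ^ 2 * b := by gcongr
      _ = (b * (1 + x) ^ 2) * (1 + y) ^ 2 := by ring
      _ ≤ _ := by gcongr
  have h3 : Real.logb 2 (3 + b) ≤ 2 := by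
    rw [Real.logb_le_iff_le_rpow (by norm_num) (by positivity)]
    norm_num
    linarith
  rw [Real.logb_inv] at h1
  linarith
end

section
/- Let u, v, w be unit vectors in ℂ² and let ρ ≥ 0 be real. Then log₂(1+ρ) − log₂ det( I₂ + v vᴴ + w wᴴ + ρ·u uᴴ ) + log₂ det( I₂ + v vᴴ + w wᴴ ) ≤ 2. -/
open Matrix Real

/-- The unit-norm condition in real coordinates. -/
lemma unit_coords (u : Fin 2 → ℂ) (hu : star u ⬝ᵥ u = 1) :
    (u 0).re ^ 2 + (u 0).im ^ 2 + (u 1).re ^ 2 + (u 1).im ^ 2 = 1 := by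
  have h := congrArg Complex.re hu
  simp [dotProduct, Fin.sum_univ_two] at h
  linarith

/-- Squared modulus of the wedge of two vectors. -/
def wedgeSq (x y : Fin 2 → ℂ) : ℝ := Complex.normSq (x 0 * y 1 - x 1 * y 0)

lemma wedgeSq_nonneg (x y : Fin 2 → ℂ) : 0 ≤ wedgeSq x y := Complex.normSq_nonneg _

lemma wedgeSq_le_one (x y : Fin 2 → ℂ) (hx : star x ⬝ᵥ x = 1) (hy : star y ⬝ᵥ y = 1) :
    wedgeSq x y ≤ 1 := by
  have h1 := unit_coords x hx
  have h2 := unit_coords y hy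
  have h3 := Complex.normSq_nonneg (star (x 0) * y 0 + star (x 1) * y 1)
  have h4 : wedgeSq x y + Complex.normSq (star (x 0) * y 0 + star (x 1) * y 1)
      = ((x 0).re ^ 2 + (x 0).im ^ 2 + (x 1).re ^ 2 + (x 1).im ^ 2)
        * ((y 0).re ^ 2 + (y 0).im ^ 2 + (y 1).re ^ 2 + (y 1).im ^ 2) := by
    simp [wedgeSq, Complex.normSq_apply]
    ring
  rw [h1, h2] at h4
  linarith

lemma det_formula (u v w : Fin 2 → ℂ)
    (hu : star u ⬝ᵥ u = 1) (hv : star v ⬝ᵥ v = 1) (hw : star w ⬝ᵥ w = 1) (ρ : ℝ) :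
    ((1 : Matrix (Fin 2) (Fin 2) ℂ)
            + Matrix.vecMulVec v (star v) + Matrix.vecMulVec w (star w)
            + (ρ : ℂ) • Matrix.vecMulVec u (star u)).det.re
      = 3 + ρ + wedgeSq v w + ρ * wedgeSq v u + ρ * wedgeSq w u := by
  have h1 := unit_coords u hu
  have h2 := unit_coords v hv
  have h3 := unit_coords w hw
  simp [Matrix.det_fin_two, Matrix.vecMulVec_apply, wedgeSq, Complex.normSq_apply]
  linear_combination ρ * h1 + h2 + h3

/-- the single-user outer bound `log₂(1+ρ)` exceeds the single-user
achievable rate of the Han–Kobayashi scheme by at most 2 bits. -/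
theorem single_user_two_bit_gap
    (u v w : Fin 2 → ℂ)
    (hu : star u ⬝ᵥ u = 1) (hv : star v ⬝ᵥ v = 1) (hw : star w ⬝ᵥ w = 1)
    (ρ : ℝ) (hρ : 0 ≤ ρ) :
    Real.logb 2 (1 + ρ)
      - Real.logb 2
          (((1 : Matrix (Fin 2) (Fin 2) ℂ)
            + Matrix.vecMulVec v (star v) + Matrix.vecMulVec w (star w)
            + (ρ : ℂ) • Matrix.vecMulVec u (star u)).det.re)
      + Real.logb 2
          (((1 : Matrix (Fin 2) (Fin 2) ℂ)
            + Matrix.vecMulVec v (star v) + Matrix.vecMulVec w (star w)).det.re)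
    ≤ 2 := by
  have e0 := det_formula u v w hu hv hw 0
  simp only [Complex.ofReal_zero, zero_smul, add_zero, zero_mul] at e0
  rw [det_formula u v w hu hv hw ρ, e0]
  have a := wedgeSq_nonneg v w
  have b := mul_nonneg hρ (wedgeSq_nonneg v u)
  have c := mul_nonneg hρ (wedgeSq_nonneg w u)
  have d := wedgeSq_le_one v w hv hw
  have l1 : Real.logb 2 (1 + ρ) ≤
      Real.logb 2 (3 + ρ + wedgeSq v w + ρ * wedgeSq v u + ρ * wedgeSq w u) :=
    Real.logb_le_logb_of_le (by norm_num) (by linarith) (by linarith)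
  have l2 : Real.logb 2 (3 + wedgeSq v w) ≤ Real.logb 2 ((2 : ℝ) ^ (2 : ℝ)) :=
    Real.logb_le_logb_of_le (by norm_num) (by linarith) (by norm_num; linarith)
  rw [Real.logb_rpow (by norm_num) (by norm_num)] at l2
  linarith
end

section
/- Let N ≥ 1 be an integer, let H be an invertible N×N complex matrix, let h ∈ ℂᴺ be a nonzero vector, and let α ≥ 0 be real. Consider f(ρ) = log₂ det( I_N + (I_N + ρ^α·H Hᴴ)⁻¹·ρ·h hᴴ ). If α ≥ 1 then f is bounded on [1, ∞); if 0 ≤ α ≤ 1 then ρ ↦ f(ρ) − (1−α)·log₂ ρ is bounded on [1, ∞). -/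
open Matrix Real

open scoped ComplexOrder in
lemma quad_form_aux (N : ℕ) (H : Matrix (Fin N) (Fin N) ℂ) (hH : IsUnit H.det)
    (h : Fin N → ℂ) (hh : h ≠ 0) :
    ∃ (l : Fin N → ℝ) (w : Fin N → ℂ), (∀ i, 0 < l i) ∧ w ≠ 0 ∧ ∀ t r : ℝ, 0 ≤ t →
      ((1 : Matrix (Fin N) (Fin N) ℂ)
              + ((1 : Matrix (Fin N) (Fin N) ℂ) + (t : ℂ) • (H * Hᴴ))⁻¹
                * ((r : ℂ) • Matrix.vecMulVec h (star h))).det.re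
        = 1 + r * ∑ i, Complex.normSq (w i) / (1 + t * l i) := by
  have hpd : (H * Hᴴ).PosDef := by
    apply Matrix.PosDef.mul_conjTranspose_self
    exact Matrix.vecMul_injective_of_isUnit ((Matrix.isUnit_iff_isUnit_det H).2 hH)
  have hA := hpd.isHermitian
  set U : Matrix (Fin N) (Fin N) ℂ := (hA.eigenvectorUnitary : Matrix (Fin N) (Fin N) ℂ) with hU
  have hUU : U * Uᴴ = 1 := Unitary.mul_star_self_of_mem hA.eigenvectorUnitary.2
  have hUU' : Uᴴ * U = 1 := Unitary.star_mul_self_of_mem hA.eigenvectorUnitary.2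
  have hs : H * Hᴴ = U * diagonal (fun i => (hA.eigenvalues i : ℂ)) * Uᴴ := by
    have := hA.spectral_theorem
    rw [Unitary.conjStarAlgAut_apply] at this
    exact this
  refine ⟨hA.eigenvalues, Uᴴ *ᵥ h, hpd.eigenvalues_pos, ?_, ?_⟩
  · intro h0
    apply hh
    have : U *ᵥ (Uᴴ *ᵥ h) = h := by rw [mulVec_mulVec, hUU, one_mulVec]
    rw [← this, h0, mulVec_zero]
  intro t r ht
  have hpos : ∀ i, 0 < 1 + t * hA.eigenvalues i := fun i => by
    have := hpd.eigenvalues_pos i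
    positivity
  generalize hA.eigenvalues = l at *
  have hinv : ((1 : Matrix (Fin N) (Fin N) ℂ) + (t : ℂ) • (H * Hᴴ))⁻¹
      = U * diagonal (fun i => (((1 + t * l i)⁻¹ : ℝ) : ℂ)) * Uᴴ := by
    apply Matrix.inv_eq_right_inv
    have h1 : (1 : Matrix (Fin N) (Fin N) ℂ) + (t : ℂ) • (H * Hᴴ)
        = U * diagonal (fun i => ((1 + t * l i : ℝ) : ℂ)) * Uᴴ := by
      have : diagonal (fun i => ((1 + t * l i : ℝ) : ℂ))
          = 1 + (t : ℂ) • diagonal (fun i => (l i : ℂ)) := by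
        rw [← diagonal_one, ← diagonal_smul, diagonal_add]
        congr 1; ext i; simp
      rw [this, hs, mul_add, add_mul, mul_one, hUU]
      simp
    rw [h1]
    calc _ = U * (diagonal (fun i => ((1 + t * l i : ℝ) : ℂ)) * (Uᴴ * U) *
            diagonal (fun i => (((1 + t * l i)⁻¹ : ℝ) : ℂ))) * Uᴴ := by
          simp only [Matrix.mul_assoc]
      _ = 1 := by
          rw [hUU', mul_one, diagonal_mul_diagonal]
          have : (fun i => ((1 + t * l i : ℝ) : ℂ) * (((1 + t * l i)⁻¹ : ℝ) : ℂ)) = fun _ => 1 := by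
            ext i
            rw [← Complex.ofReal_mul, mul_inv_cancel₀ (hpos i).ne', Complex.ofReal_one]
          rw [this, diagonal_one, mul_one, hUU]
  rw [hinv, Matrix.mul_smul, mul_vecMulVec, ← smul_vecMulVec, vecMulVec_eq Unit,
    det_one_add_replicateCol_mul_replicateRow, dotProduct_smul, ← mulVec_mulVec, ← mulVec_mulVec]
  have : star h ⬝ᵥ U *ᵥ (diagonal (fun i => (((1 + t * l i)⁻¹ : ℝ) : ℂ)) *ᵥ (Uᴴ *ᵥ h))
      = ((∑ i, Complex.normSq ((Uᴴ *ᵥ h) i) / (1 + t * l i) : ℝ) : ℂ) := by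
    rw [dotProduct_mulVec]
    have : star h ᵥ* U = star (Uᴴ *ᵥ h) := by
      rw [star_mulVec, conjTranspose_conjTranspose]
    rw [this]
    simp only [dotProduct, mulVec_diagonal, Pi.star_apply, Complex.ofReal_sum]
    refine Finset.sum_congr rfl fun i _ => ?_
    rw [div_eq_inv_mul, Complex.ofReal_mul, Complex.normSq_eq_conj_mul_self]
    simp only [RCLike.star_def]
    ring
  rw [this, smul_eq_mul, ← Complex.ofReal_mul, Complex.add_re, Complex.ofReal_re, Complex.one_re]

lemma bounds_aux (N : ℕ) (H : Matrix (Fin N) (Fin N) ℂ) (hH : IsUnit H.det)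
    (h : Fin N → ℂ) (hh : h ≠ 0) :
    ∃ a b : ℝ, 0 < a ∧ 0 < b ∧ ∀ α ρ : ℝ, 0 ≤ α → 1 ≤ ρ → 
      1 + a * ρ ^ (1 - α) ≤ ((1 : Matrix (Fin N) (Fin N) ℂ)
              + ((1 : Matrix (Fin N) (Fin N) ℂ) + ((ρ ^ α : ℝ) : ℂ) • (H * Hᴴ))⁻¹
                * ((ρ : ℂ) • Matrix.vecMulVec h (star h))).det.re ∧ 
      ((1 : Matrix (Fin N) (Fin N) ℂ)
              + ((1 : Matrix (Fin N) (Fin N) ℂ) + ((ρ ^ α : ℝ) : ℂ) • (H * Hᴴ))⁻¹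
                * ((ρ : ℂ) • Matrix.vecMulVec h (star h))).det.re ≤ 1 + b * ρ ^ (1 - α) := by
  obtain ⟨l, w, hl, hw, hdet⟩ := quad_form_aux N H hH h hh
  obtain ⟨j, hj⟩ := Function.ne_iff.1 hw
  have hj : 0 < Complex.normSq (w j) := Complex.normSq_pos.2 hj
  refine ⟨∑ i, Complex.normSq (w i) / (1 + l i), ∑ i, Complex.normSq (w i) / l i, ?_, ?_, ?_⟩
  · refine Finset.sum_pos' (fun i _ => ?_) ⟨j, Finset.mem_univ _, ?_⟩
    · exact div_nonneg (Complex.normSq_nonneg _) (by linarith [hl i])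
    · exact div_pos hj (by linarith [hl j])
  · refine Finset.sum_pos' (fun i _ => ?_) ⟨j, Finset.mem_univ _, ?_⟩
    · exact div_nonneg (Complex.normSq_nonneg _) (hl i).le
    · exact div_pos hj (hl j)
  intro α ρ hα hρ
  have hρ0 : 0 < ρ := by linarith
  have ht : 1 ≤ ρ ^ α := Real.one_le_rpow hρ hα
  rw [hdet _ _ (by linarith), Real.rpow_sub hρ0, Real.rpow_one]
  generalize ρ ^ α = t at *
  have ht0 : 0 < t := by linarith
  have e : ∀ S : ℝ, S * (ρ / t) = ρ * (S / t) := fun S => by ring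
  rw [e, e, Finset.sum_div, Finset.sum_div]
  constructor
  · refine add_le_add le_rfl (mul_le_mul_of_nonneg_left (Finset.sum_le_sum fun i _ => ?_) hρ0.le)
    rw [div_div]
    have h1 := hl i
    have h2 := mul_pos ht0 h1
    exact div_le_div_of_nonneg_left (Complex.normSq_nonneg (w i)) (by linarith) (by nlinarith)
  · refine add_le_add le_rfl (mul_le_mul_of_nonneg_left (Finset.sum_le_sum fun i _ => ?_) hρ0.le)
    rw [div_div]
    have h1 := hl i
    have h2 := mul_pos ht0 h1
    exact div_le_div_of_nonneg_left (Complex.normSq_nonneg (w i)) (by nlinarith) (by nlinarith)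

/-- evaluation of the desired user's rate term in the many-to-one GDOF
outer bound: `f(ρ) = log₂ det(I + (I + ρ^α H Hᴴ)⁻¹ ρ h hᴴ)` is `O(1)` when `α ≥ 1` and
`(1−α)·log₂ρ + O(1)` when `0 ≤ α ≤ 1`. -/
theorem many_to_one_desired_term (N : ℕ) (hN : 1 ≤ N)
    (H : Matrix (Fin N) (Fin N) ℂ) (hH : IsUnit H.det)
    (h : Fin N → ℂ) (hh : h ≠ 0)
    (α : ℝ) (hα : 0 ≤ α) :
    (1 ≤ α →
      ∃ C : ℝ, ∀ ρ : ℝ, 1 ≤ ρ →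
        |Real.logb 2
            (((1 : Matrix (Fin N) (Fin N) ℂ)
              + ((1 : Matrix (Fin N) (Fin N) ℂ) + ((ρ ^ α : ℝ) : ℂ) • (H * Hᴴ))⁻¹
                * ((ρ : ℂ) • Matrix.vecMulVec h (star h))).det.re)| ≤ C) ∧
    (α ≤ 1 →
      ∃ C : ℝ, ∀ ρ : ℝ, 1 ≤ ρ →
        |Real.logb 2
            (((1 : Matrix (Fin N) (Fin N) ℂ)
              + ((1 : Matrix (Fin N) (Fin N) ℂ) + ((ρ ^ α : ℝ) : ℂ) • (H * Hᴴ))⁻¹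
                * ((ρ : ℂ) • Matrix.vecMulVec h (star h))).det.re)
          - (1 - α) * Real.logb 2 ρ| ≤ C) := by
  obtain ⟨a, b, ha, hb, hab⟩ := bounds_aux N H hH h hh
  constructor
  · intro h1
    refine ⟨Real.logb 2 (1 + b), fun ρ hρ => ?_⟩
    obtain ⟨hl, hu⟩ := hab α ρ hα hρ
    generalize Complex.re (Matrix.det (_ : Matrix (Fin N) (Fin N) ℂ)) = D at hl hu ⊢
    have hp : 0 < ρ ^ (1 - α) := Real.rpow_pos_of_pos (by linarith) _
    have hp1 : ρ ^ (1 - α) ≤ 1 := Real.rpow_le_one_of_one_le_of_nonpos hρ (by linarith)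
    have hD : 1 ≤ D := by nlinarith [mul_pos ha hp]
    rw [abs_of_nonneg (Real.logb_nonneg (by norm_num) hD)]
    exact Real.logb_le_logb_of_le (by norm_num) (by linarith) (by nlinarith)
  · intro h1
    refine ⟨|Real.logb 2 a| + |Real.logb 2 (1 + b)|, fun ρ hρ => ?_⟩
    obtain ⟨hl, hu⟩ := hab α ρ hα hρ
    generalize Complex.re (Matrix.det (_ : Matrix (Fin N) (Fin N) ℂ)) = D at hl hu ⊢
    have hρ0 : 0 < ρ := by linarith
    have hp1 : 1 ≤ ρ ^ (1 - α) := Real.one_le_rpow hρ (by linarith)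
    rw [← Real.logb_rpow_eq_mul_logb_of_pos hρ0]
    generalize ρ ^ (1 - α) = p at hl hu hp1 ⊢
    have hp : 0 < p := by linarith
    have hD : 1 ≤ D := by nlinarith [mul_pos ha hp]
    rw [← Real.logb_div (by linarith) hp.ne']
    have h2 : Real.logb 2 a ≤ Real.logb 2 (D / p) :=
      Real.logb_le_logb_of_le (by norm_num) ha (by rw [le_div_iff₀ hp]; linarith)
    have h3 : Real.logb 2 (D / p) ≤ Real.logb 2 (1 + b) :=
      Real.logb_le_logb_of_le (by norm_num) (by positivity) (by rw [div_le_iff₀ hp]; nlinarith)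
    rw [abs_le]
    constructor
    · linarith [neg_abs_le (Real.logb 2 a), abs_nonneg (Real.logb 2 (1 + b))]
    · linarith [le_abs_self (Real.logb 2 (1 + b)), abs_nonneg (Real.logb 2 a)]
end
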